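/- arXiv:math-ph/0002010 — 2 statements merged into one kernel-verified Lean document; each statement's English description precedes it below -/
import Mathlib

section
/- Let φ : [0,1] → ℝ be C¹ with |φ'(x)| ≥ C₁ > 0 for all x, let A ≥ 0, and for each N ∈ ℕ let ε_N : [0,1] → ℝ be C¹ with sup_{x∈[0,1]} (|ε_N(x)| + |ε_N'(x)|) ≤ A/N; set Φ_N = φ + ε_N. Fix L > 0 and real numbers a < b. Then lim_{N→∞} (1/(b−a)) ∫_a^b Σ_{2,t}^{(N)}(L) dt = L, where Σ_{2,t}^{(N)}(L) = (2/π²) Σ_{ℓ=1}^{∞} ℓ^{−2} sin²(π ℓ L / N) |S_t(N,ℓ)|² and S_t(N,ℓ) = Σ_{j=1}^N exp(i t ℓ N Φ_N(j/N)). -/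
open MeasureTheory Filter Topology Real

theorem hasSum_sin_sq_div_sq {x : ℝ} (hx : x ∈ Set.Icc (0 : ℝ) 1) :
    HasSum (fun n : ℕ => 1 / ((n : ℝ) + 1) ^ 2 * Real.sin (π * ((n : ℝ) + 1) * x) ^ 2)
      (π ^ 2 / 2 * (x - x ^ 2)) := by
  have hcos := hasSum_one_div_nat_pow_mul_cos one_ne_zero hx
  have h := (hasSum_zeta_two.sub hcos).div_const 2
  rw [← hasSum_nat_add_iff' 1] at h
  have hterm : (fun n : ℕ => 1 / ((n : ℝ) + 1) ^ 2 * Real.sin (π * ((n : ℝ) + 1) * x) ^ 2) =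
      fun n : ℕ => (1 / ((n + 1 : ℕ) : ℝ) ^ 2 -
        1 / ((n + 1 : ℕ) : ℝ) ^ (2 * 1) * Real.cos (2 * π * ((n + 1 : ℕ) : ℝ) * x)) / 2 := by
    funext n
    rw [Real.sin_sq_eq_half_sub]
    push_cast
    rw [show 2 * (π * ((n : ℝ) + 1) * x) = 2 * π * ((n : ℝ) + 1) * x by ring]
    ring
  have hB : (Polynomial.map (algebraMap ℚ ℝ) (Polynomial.bernoulli (2 * 1))).eval x
      = x ^ 2 - x + 1 / 6 := by
    simp [Polynomial.bernoulli, Finset.sum_range_succ, bernoulli_eq_bernoulli'_of_ne_one]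
    ring
  rw [hterm]
  refine (congrArg (HasSum _) ?_).mpr h
  rw [hB]
  simp
  ring

theorem abs_integral_cos_mul_le (a b c : ℝ) (hc : c ≠ 0) :
    |∫ t in a..b, Real.cos (t * c)| ≤ 2 / |c| := by
  rw [intervalIntegral.integral_comp_mul_right _ hc, integral_cos, smul_eq_mul, abs_mul, abs_inv,
    div_eq_inv_mul]
  gcongr
  have h1 := abs_le.1 (Real.abs_sin_le_one (b * c))
  have h2 := abs_le.1 (Real.abs_sin_le_one (a * c))
  rw [abs_le]
  constructor <;> linarith

theorem norm_sum_exp_I_sq {ι : Type*} (s : Finset ι) (x : ι → ℝ) :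
    ‖∑ j ∈ s, Complex.exp (Complex.I * (x j : ℂ))‖ ^ 2 =
      ∑ j ∈ s, ∑ k ∈ s, Real.cos (x j - x k) := by
  simp_rw [mul_comm Complex.I]
  rw [← Complex.normSq_eq_norm_sq, Complex.normSq_apply, Complex.re_sum, Complex.im_sum]
  simp only [Complex.exp_ofReal_mul_I_re, Complex.exp_ofReal_mul_I_im, Finset.sum_mul_sum,
    ← Finset.sum_add_distrib, Real.cos_sub]

theorem sum_inv_abs_sub_le (N j : ℕ) (hj : j ∈ Finset.Icc 1 N) :
    ∑ k ∈ Finset.Icc 1 N, 1 / |(j : ℝ) - k| ≤ 2 * (1 + Real.log N) := by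
  obtain ⟨h1, h2⟩ := Finset.mem_Icc.1 hj
  have hH : ∀ m ≤ N, ∑ i ∈ Finset.range m, 1 / ((i : ℝ) + 1) ≤ 1 + Real.log N := by
    intro m hm
    have h := harmonic_le_one_add_log N
    simp only [harmonic] at h
    push_cast at h
    refine le_trans ?_ h
    simp only [one_div]
    exact Finset.sum_le_sum_of_subset_of_nonneg (by simpa using hm) (fun _ _ _ => by positivity)
  have hsplit : ∑ k ∈ Finset.Icc 1 N, 1 / |(j : ℝ) - k| ≤
      ∑ k ∈ Finset.range j, 1 / |(j : ℝ) - k| + ∑ k ∈ Finset.Ico (j + 1) (N + 1),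
        1 / |(j : ℝ) - k| := by
    have : ∑ k ∈ Finset.range (N + 1), 1 / |(j : ℝ) - k| =
        ∑ k ∈ Finset.range j, 1 / |(j : ℝ) - k| + ∑ k ∈ Finset.Ico (j + 1) (N + 1),
        1 / |(j : ℝ) - k| := by
      rw [← Finset.sum_range_add_sum_Ico _ (show j + 1 ≤ N + 1 by omega), Finset.sum_range_succ]
      simp
    rw [← this]
    exact Finset.sum_le_sum_of_subset_of_nonneg
      (fun k hk => by simp at hk ⊢; omega) (fun _ _ _ => by positivity)
  have hleft : ∑ k ∈ Finset.range j, 1 / |(j : ℝ) - k| =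
      ∑ i ∈ Finset.range j, 1 / ((i : ℝ) + 1) := by
    rw [← Finset.sum_range_reflect]
    refine Finset.sum_congr rfl fun k hk => ?_
    have hk' := Finset.mem_range.1 hk
    have : ((j - 1 - k : ℕ) : ℝ) = j - 1 - k := by
      rw [Nat.cast_sub (by omega), Nat.cast_sub h1]; simp
    rw [this, show (j : ℝ) - (j - 1 - k) = k + 1 by ring, abs_of_pos (by positivity)]
  have hright : ∑ k ∈ Finset.Ico (j + 1) (N + 1), 1 / |(j : ℝ) - k| =
      ∑ i ∈ Finset.range (N - j), 1 / ((i : ℝ) + 1) := by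
    rw [Finset.sum_Ico_eq_sum_range, show N + 1 - (j + 1) = N - j by omega]
    refine Finset.sum_congr rfl fun k _ => ?_
    push_cast
    rw [abs_sub_comm, show (j : ℝ) + 1 + k - j = k + 1 by ring, abs_of_pos (by positivity)]
  have := hH j h2
  have := hH (N - j) (by omega)
  linarith

theorem mul_abs_sub_le_of_le_abs_derivWithin {f : ℝ → ℝ} {c : ℝ}
    (hf : DifferentiableOn ℝ f (Set.Icc 0 1))
    (hc : ∀ x ∈ Set.Icc (0 : ℝ) 1, c ≤ |derivWithin f (Set.Icc 0 1) x|)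
    {x y : ℝ} (hx : x ∈ Set.Icc (0 : ℝ) 1) (hy : y ∈ Set.Icc (0 : ℝ) 1) :
    c * |x - y| ≤ |f x - f y| := by
  wlog hxy : y < x generalizing x y
  · rcases (not_lt.1 hxy).eq_or_lt with rfl | h
    · simp
    · rw [abs_sub_comm, abs_sub_comm (f x)]
      exact this hy hx h
  have hsub : Set.Icc y x ⊆ Set.Icc 0 1 := Set.Icc_subset_Icc hy.1 hx.2
  have hnhds : ∀ z ∈ Set.Ioo y x, Set.Icc (0 : ℝ) 1 ∈ 𝓝 z := fun z hz =>
    Icc_mem_nhds (hy.1.trans_lt hz.1) (hz.2.trans_le hx.2)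
  obtain ⟨z, hz, hslope⟩ := exists_deriv_eq_slope f hxy (hf.continuousOn.mono hsub)
    (fun z hz => (hf.differentiableAt (hnhds z hz)).differentiableWithinAt)
  have h := hc z (hsub ⟨hz.1.le, hz.2.le⟩)
  rw [derivWithin_of_mem_nhds (hnhds z hz), hslope, abs_div] at h
  exact (le_div_iff₀ (abs_pos.2 (sub_pos.2 hxy).ne')).1 h

theorem sin_sq_le_rpow {x : ℝ} (hx : 0 ≤ x) : Real.sin x ^ 2 ≤ x ^ (3 / 2 : ℝ) := by
  rw [← sq_abs, ← Real.rpow_natCast]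
  calc |Real.sin x| ^ ((2 : ℕ) : ℝ) ≤ |Real.sin x| ^ (3 / 2 : ℝ) :=
        Real.rpow_le_rpow_of_exponent_ge_of_imp (abs_nonneg _) (Real.abs_sin_le_one x)
          (by norm_num) (by norm_num)
    _ ≤ x ^ (3 / 2 : ℝ) :=
        Real.rpow_le_rpow (abs_nonneg _) (Real.abs_sin_le_abs.trans (abs_of_nonneg hx).le)
          (by norm_num)

theorem abs_integral_norm_sum_exp_sq_sub_le (N : ℕ) (x : ℕ → ℝ) {κ : ℝ} (hκ : 0 < κ)
    (hsep : ∀ j ∈ Finset.Icc 1 N, ∀ k ∈ Finset.Icc 1 N, κ * |(j : ℝ) - k| ≤ |x j - x k|)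
    {a b : ℝ} :
    |(∫ t in a..b, ‖∑ j ∈ Finset.Icc 1 N, Complex.exp (Complex.I * ((t * x j : ℝ) : ℂ))‖ ^ 2) -
      (b - a) * N| ≤ 4 * N * (1 + Real.log N) / κ := by
  have hint : (∫ t in a..b,
      ‖∑ j ∈ Finset.Icc 1 N, Complex.exp (Complex.I * ((t * x j : ℝ) : ℂ))‖ ^ 2) =
      ∑ j ∈ Finset.Icc 1 N, ∑ k ∈ Finset.Icc 1 N, ∫ t in a..b, Real.cos (t * (x j - x k)) := by
    simp_rw [norm_sum_exp_I_sq, ← mul_sub]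
    rw [intervalIntegral.integral_finsetSum]
    · refine Finset.sum_congr rfl fun j _ => ?_
      rw [intervalIntegral.integral_finsetSum]
      intro k _
      exact Continuous.intervalIntegrable (by fun_prop) _ _
    · intro j _
      exact Continuous.intervalIntegrable (by fun_prop) _ _
  have hdiag : (b - a) * N =
      ∑ j ∈ Finset.Icc 1 N, ∑ k ∈ Finset.Icc 1 N, if j = k then b - a else 0 := by
    rw [Finset.sum_congr rfl fun j hj => by rw [Finset.sum_ite_eq, if_pos hj]]
    simp only [Finset.sum_const, Nat.card_Icc, Nat.add_sub_cancel, nsmul_eq_mul]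
    ring
  have hterm : ∀ j ∈ Finset.Icc 1 N, ∀ k ∈ Finset.Icc 1 N,
      |(∫ t in a..b, Real.cos (t * (x j - x k))) - if j = k then b - a else 0| ≤
        2 / κ * (1 / |(j : ℝ) - k|) := by
    intro j hj k hk
    by_cases hjk : j = k
    · simp [hjk]
    · have hpos : 0 < |(j : ℝ) - k| := abs_pos.2 (sub_ne_zero.2 (Nat.cast_injective.ne hjk))
      have hpos' : 0 < κ * |(j : ℝ) - k| := mul_pos hκ hpos
      have hx := hsep j hj k hk
      rw [if_neg hjk, sub_zero]
      refine (abs_integral_cos_mul_le a b _ (abs_pos.1 (hpos'.trans_le hx))).trans ?_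
      rw [div_mul_div_comm, mul_one]
      gcongr
  rw [hint, hdiag, ← Finset.sum_sub_distrib]
  simp_rw [← Finset.sum_sub_distrib]
  calc _ ≤ ∑ j ∈ Finset.Icc 1 N, ∑ k ∈ Finset.Icc 1 N, 2 / κ * (1 / |(j : ℝ) - k|) :=
        (Finset.abs_sum_le_sum_abs _ _).trans <| Finset.sum_le_sum fun j hj =>
          (Finset.abs_sum_le_sum_abs _ _).trans <| Finset.sum_le_sum fun k hk => hterm j hj k hk
    _ ≤ ∑ j ∈ Finset.Icc 1 N, 2 / κ * (2 * (1 + Real.log N)) := by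
        refine Finset.sum_le_sum fun j hj => ?_
        rw [← Finset.mul_sum]
        gcongr
        exact sum_inv_abs_sub_le N j hj
    _ = 4 * N * (1 + Real.log N) / κ := by
        simp
        ring

theorem hasSum_integral_const_mul_norm_sum_exp_sq (N : ℕ) (c : ℕ → ℝ) (x : ℕ → ℕ → ℝ)
    (hc : Summable fun n => |c n|) (a b : ℝ) :
    HasSum (fun n => c n * ∫ t in a..b,
        ‖∑ j ∈ Finset.Icc 1 N, Complex.exp (Complex.I * ((t * x n j : ℝ) : ℂ))‖ ^ 2)
      (∫ t in a..b, ∑' n, c n *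
        ‖∑ j ∈ Finset.Icc 1 N, Complex.exp (Complex.I * ((t * x n j : ℝ) : ℂ))‖ ^ 2) := by
  simp_rw [← intervalIntegral.integral_const_mul]
  have hbd : ∀ n t, ‖c n * ‖∑ j ∈ Finset.Icc 1 N,
      Complex.exp (Complex.I * ((t * x n j : ℝ) : ℂ))‖ ^ 2‖ ≤ |c n| * (N : ℝ) ^ 2 := by
    intro n t
    rw [norm_mul, Real.norm_eq_abs, norm_pow, norm_norm]
    gcongr
    refine (norm_sum_le _ _).trans ?_
    simp [mul_comm Complex.I, -Complex.ofReal_mul, Complex.norm_exp_ofReal_mul_I]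
  have hsum : Summable fun n => |c n| * (N : ℝ) ^ 2 := hc.mul_right _
  refine intervalIntegral.hasSum_integral_of_dominated_convergence
    (fun n _ => |c n| * (N : ℝ) ^ 2) (fun n => ?_) (fun n => ?_) ?_ ?_ ?_
  · exact Continuous.aestronglyMeasurable (by fun_prop)
  · exact .of_forall fun t _ => hbd n t
  · exact .of_forall fun t _ => hsum
  · exact intervalIntegrable_const
  · exact .of_forall fun t _ => (Summable.of_norm_bounded hsum fun n => hbd n t).hasSum

theorem tendsto_rpow_mul_mul_one_add_log (L : ℝ) (hL : 0 < L) :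
    Tendsto (fun N : ℕ => (π * L / N) ^ (3 / 2 : ℝ) * (N * (1 + Real.log N))) atTop (𝓝 0) := by
  have h1 : Tendsto (fun y : ℝ => y ^ (-(1 / 2) : ℝ)) atTop (𝓝 0) :=
    tendsto_rpow_neg_atTop (by norm_num)
  have h2 : Tendsto (fun y : ℝ => Real.log y / y ^ (1 / 2 : ℝ)) atTop (𝓝 0) :=
    (isLittleO_log_rpow_atTop (by norm_num)).tendsto_div_nhds_zero
  have h := ((h1.add h2).const_mul ((π * L) ^ (3 / 2 : ℝ))).comp
    (tendsto_natCast_atTop_atTop (R := ℝ))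
  simp only [add_zero, mul_zero] at h
  refine h.congr' ?_
  filter_upwards [eventually_ge_atTop 1] with N hN
  have hN' : (0 : ℝ) < N := by exact_mod_cast hN
  have h32 : (N : ℝ) ^ (3 / 2 : ℝ) = N * (N : ℝ) ^ (1 / 2 : ℝ) := by
    rw [show (3 / 2 : ℝ) = 1 + 1 / 2 by norm_num, Real.rpow_add hN', Real.rpow_one]
  have := Real.rpow_pos_of_pos hN' (1 / 2)
  simp only [Function.comp]
  rw [Real.div_rpow (by positivity) hN'.le, h32, Real.rpow_neg hN'.le]
  field_simp

theorem abs_integral_numberVariance_sub_le (N : ℕ) (hN : 1 ≤ N) (y : ℕ → ℝ) {c : ℝ} (hc : 0 < c)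
    (hsep : ∀ j ∈ Finset.Icc 1 N, ∀ k ∈ Finset.Icc 1 N, c * |(j : ℝ) - k| ≤ |y j - y k|)
    {L : ℝ} (hL : 0 < L) (hLN : L ≤ N) (a b : ℝ) :
    |(∫ t in a..b, ∑' ℓ : ℕ, (1 / ((ℓ : ℝ) + 1) ^ 2 *
          Real.sin (π * ((ℓ : ℝ) + 1) * L / N) ^ 2) *
          ‖∑ j ∈ Finset.Icc 1 N, Complex.exp (Complex.I *
              ((t * (((ℓ : ℝ) + 1) * y j) : ℝ) : ℂ))‖ ^ 2) -
        (b - a) * N * (π ^ 2 / 2 * (L / N - (L / N) ^ 2))| ≤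
      (4 / c * ∑' ℓ : ℕ, ((ℓ : ℝ) + 1) ^ (-(3 / 2) : ℝ)) *
        ((π * L / N) ^ (3 / 2 : ℝ) * (N * (1 + Real.log N))) := by
  have hN' : (0 : ℝ) < N := by exact_mod_cast hN
  have hw : HasSum (fun ℓ : ℕ => 1 / ((ℓ : ℝ) + 1) ^ 2 *
      Real.sin (π * ((ℓ : ℝ) + 1) * L / N) ^ 2) (π ^ 2 / 2 * (L / N - (L / N) ^ 2)) := by
    have := hasSum_sin_sq_div_sq (x := L / N) ⟨by positivity, (div_le_one hN').2 hLN⟩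
    simpa only [mul_div_assoc] using this
  have hI := hasSum_integral_const_mul_norm_sum_exp_sq N _ (fun ℓ j => ((ℓ : ℝ) + 1) * y j)
    hw.summable.abs a b
  have hdiff := hI.sub (hw.mul_left ((b - a) * N))
  rw [← hdiff.tsum_eq, ← Real.norm_eq_abs]
  have hsummable : Summable fun ℓ : ℕ => ((ℓ : ℝ) + 1) ^ (-(3 / 2) : ℝ) := by
    have := (summable_nat_add_iff 1).2
      (Real.summable_nat_rpow.2 (show (-(3 / 2) : ℝ) < -1 by norm_num))
    simpa using this
  refine tsum_of_norm_bounded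
    ((hsummable.hasSum.mul_left (4 / c)).mul_right _) fun ℓ => ?_
  have hℓ : (0 : ℝ) < (ℓ : ℝ) + 1 := by positivity
  have hR := abs_integral_norm_sum_exp_sq_sub_le N (fun j => ((ℓ : ℝ) + 1) * y j)
    (mul_pos hℓ hc) (a := a) (b := b) fun j hj k hk => by
      rw [← mul_sub, abs_mul, abs_of_pos hℓ, mul_assoc]
      exact mul_le_mul_of_nonneg_left (hsep j hj k hk) hℓ.le
  have hs : Real.sin (π * ((ℓ : ℝ) + 1) * L / N) ^ 2 ≤
      ((ℓ : ℝ) + 1) ^ (3 / 2 : ℝ) * (π * L / N) ^ (3 / 2 : ℝ) := by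
    rw [← Real.mul_rpow hℓ.le (by positivity)]
    refine (sin_sq_le_rpow (by positivity)).trans_eq ?_
    congr 1
    ring
  have hexp : ((ℓ : ℝ) + 1) ^ (-(3 / 2) : ℝ) =
      ((ℓ : ℝ) + 1) ^ (3 / 2 : ℝ) / ((ℓ : ℝ) + 1) ^ 3 := by
    rw [← Real.rpow_natCast, ← Real.rpow_sub hℓ]
    norm_num
  have hlog : 0 ≤ Real.log N := Real.log_natCast_nonneg N
  rw [mul_comm ((b - a) * (N : ℝ)), ← mul_sub, norm_mul, Real.norm_eq_abs, Real.norm_eq_abs,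
    abs_of_nonneg (by positivity)]
  calc _ ≤ 1 / ((ℓ : ℝ) + 1) ^ 2 *
        (((ℓ : ℝ) + 1) ^ (3 / 2 : ℝ) * (π * L / N) ^ (3 / 2 : ℝ)) *
        (4 * N * (1 + Real.log N) / (((ℓ : ℝ) + 1) * c)) := by gcongr
    _ = _ := by
        rw [hexp]
        field_simp

/-- Zelditch, Theorem 4.7.1 (Theorem B(a), number variance part): the number variance
`Σ_{2,t}^{(N)}(L) = (2/π²) Σ_{ℓ=1}^∞ ℓ⁻² sin²(πℓL/N) |S_t(N,ℓ)|²` of the quantized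
Hamilton flow `U_{t,N}` is Poisson (equal to `L`) on average in `t`. -/
theorem number_variance_poisson_on_average
    (φ : ℝ → ℝ) (C₁ : ℝ) (hC₁ : 0 < C₁)
    (hφ : ContDiffOn ℝ 1 φ (Set.Icc 0 1))
    (hφ' : ∀ x ∈ Set.Icc (0:ℝ) 1, C₁ ≤ |derivWithin φ (Set.Icc 0 1) x|)
    (A : ℝ) (hA : 0 ≤ A) (ε : ℕ → ℝ → ℝ)
    (hε : ∀ N : ℕ, 1 ≤ N → ContDiffOn ℝ 1 (ε N) (Set.Icc 0 1))
    (hεbd : ∀ N : ℕ, 1 ≤ N → ∀ x ∈ Set.Icc (0:ℝ) 1,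
      |ε N x| + |derivWithin (ε N) (Set.Icc 0 1) x| ≤ A / N)
    (L : ℝ) (hL : 0 < L) (a b : ℝ) (hab : a < b) :
    Tendsto
      (fun N : ℕ => (1 / (b - a)) * ∫ t in a..b,
        (2 / π ^ 2) * ∑' ℓ : ℕ, (1 / ((ℓ : ℝ) + 1) ^ 2) *
          Real.sin (π * ((ℓ : ℝ) + 1) * L / N) ^ 2 *
          ‖∑ j ∈ Finset.Icc 1 N, Complex.exp (Complex.I *
              ((t * ((ℓ : ℝ) + 1) * N * (φ ((j : ℝ) / N) + ε N ((j : ℝ) / N)) : ℝ) : ℂ))‖ ^ 2)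
      atTop (𝓝 L) := by
  have hbound := (tendsto_rpow_mul_mul_one_add_log L hL).const_mul
    (1 / (b - a) * (2 / π ^ 2) *
      (4 / (C₁ / 2) * ∑' ℓ : ℕ, ((ℓ : ℝ) + 1) ^ (-(3 / 2) : ℝ)))
  rw [mul_zero] at hbound
  have hmain : Tendsto (fun N : ℕ => L - L ^ 2 / (N : ℝ)) atTop (𝓝 L) := by
    simpa using (tendsto_const_div_atTop_nhds_zero_nat (L ^ 2)).const_sub L
  refine tendsto_of_tendsto_of_dist hmain ?_
  refine squeeze_zero' (.of_forall fun _ => dist_nonneg) ?_ hbound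
  filter_upwards [eventually_ge_atTop 1, eventually_ge_atTop ⌈L⌉₊,
    eventually_ge_atTop ⌈2 * A / C₁⌉₊] with N hN hLN hAN
  have hN' : (0 : ℝ) < N := by exact_mod_cast hN
  have hA' : A / N ≤ C₁ / 2 := by
    have h := Nat.ceil_le.1 hAN
    rw [div_le_iff₀ hC₁] at h
    rw [div_le_iff₀ hN']
    linarith
  have hsep : ∀ j ∈ Finset.Icc 1 N, ∀ k ∈ Finset.Icc 1 N, C₁ / 2 * |(j : ℝ) - k| ≤
      |N * (φ ((j : ℝ) / N) + ε N ((j : ℝ) / N)) - N * (φ ((k : ℝ) / N) + ε N ((k : ℝ) / N))| := by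
    have hmem : ∀ j ∈ Finset.Icc 1 N, (j : ℝ) / N ∈ Set.Icc (0 : ℝ) 1 := fun j hj =>
      ⟨by positivity, (div_le_one hN').2 (by exact_mod_cast (Finset.mem_Icc.1 hj).2)⟩
    intro j hj k hk
    have h1 := mul_abs_sub_le_of_le_abs_derivWithin (hφ.differentiableOn one_ne_zero) hφ'
      (hmem j hj) (hmem k hk)
    have h2 := (convex_Icc (0 : ℝ) 1).norm_image_sub_le_of_norm_derivWithin_le
      ((hε N hN).differentiableOn one_ne_zero) (C := C₁ / 2)
      (fun x hx => by
        have := hεbd N hN x hx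
        have := abs_nonneg (ε N x)
        rw [Real.norm_eq_abs]
        linarith) (hmem k hk) (hmem j hj)
    rw [Real.norm_eq_abs, Real.norm_eq_abs] at h2
    have h3 := abs_sub_abs_le_abs_sub (φ ((j : ℝ) / N) - φ ((k : ℝ) / N))
      (-(ε N ((j : ℝ) / N) - ε N ((k : ℝ) / N)))
    rw [abs_neg] at h3
    have hjk : |(j : ℝ) - k| = N * |(j : ℝ) / N - k / N| := by
      rw [← sub_div, abs_div, abs_of_pos hN']
      field_simp
    rw [← mul_sub, abs_mul, abs_of_pos hN', hjk, mul_left_comm]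
    refine mul_le_mul_of_nonneg_left ?_ hN'.le
    refine le_trans ?_ (h3.trans_eq (congrArg abs (by ring)))
    linarith
  have key := abs_integral_numberVariance_sub_le N hN _ (half_pos hC₁) hsep hL
    (Nat.ceil_le.1 hLN) a b
  have hba : 0 < b - a := sub_pos.2 hab
  have hmul := mul_le_mul_of_nonneg_left key
    (show 0 ≤ 1 / (b - a) * (2 / π ^ 2) by positivity)
  rw [← abs_of_nonneg (show 0 ≤ 1 / (b - a) * (2 / π ^ 2) by positivity), ← abs_mul,
    abs_of_nonneg (show 0 ≤ 1 / (b - a) * (2 / π ^ 2) by positivity), mul_sub] at hmul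
  rw [dist_comm, Real.dist_eq, intervalIntegral.integral_const_mul, ← mul_assoc]
  have hval : 1 / (b - a) * (2 / π ^ 2) *
      ((b - a) * N * (π ^ 2 / 2 * (L / N - (L / N) ^ 2))) = L - L ^ 2 / N := by
    field_simp
  rw [hval] at hmul
  simpa only [mul_assoc] using hmul
end

section
/- Fix t ≠ 0, T > 0, and a Schwartz function f whose Fourier transform f̂ is compactly supported. For N ∈ ℕ and α, β ∈ ℝ define ρ^{(N)}_{t,α,β}(f) = (1/N²) Σ_{ℓ∈ℤ} f̂(2πℓ/N) |Σ_{j=1}^N exp(i t ℓ (α j²/N + β j))|². Then there is a constant C such that for all N ≥ 2, (1/(2T)²) ∫_{−T}^{T} ∫_{−T}^{T} | ρ^{(N)}_{t,α,β}(f) − (f(0) + f̂(0)) |² dα dβ ≤ C (log N)³ / N. -/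
open MeasureTheory Filter Topology Real

/-- Fourier transform with the convention `f̂(ξ) = ∫ f(x) e^{-i x ξ} dx`. -/
noncomputable def FT (f : ℝ → ℝ) (ξ : ℝ) : ℂ :=
  ∫ x : ℝ, (f x : ℂ) * Complex.exp (-(Complex.I * x * ξ))

lemma sum_gcd_div_mul_le (N : ℕ) :
    ∑ p ∈ Finset.Icc 1 N ×ˢ Finset.Icc 1 N, (Nat.gcd p.1 p.2 : ℝ) / (p.1 * p.2) ≤
      (∑ g ∈ Finset.Icc 1 N, (1 : ℝ) / g) ^ 3 := by
  let φ : ℕ × ℕ → ℕ × ℕ × ℕ :=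
    fun p => (p.1.gcd p.2, p.1 / p.1.gcd p.2, p.2 / p.1.gcd p.2)
  let F : ℕ × ℕ × ℕ → ℝ := fun q => (1 : ℝ) / q.1 * (1 / q.2.1 * (1 / q.2.2))
  have hR : (∑ g ∈ Finset.Icc 1 N, (1 : ℝ) / g) ^ 3 =
      ∑ q ∈ Finset.Icc 1 N ×ˢ Finset.Icc 1 N ×ˢ Finset.Icc 1 N, F q := by
    rw [Finset.sum_product, pow_succ, pow_two, mul_assoc, Finset.sum_mul]
    refine Finset.sum_congr rfl fun g _ => ?_
    rw [Finset.sum_product, Finset.sum_mul, Finset.mul_sum]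
    refine Finset.sum_congr rfl fun u _ => ?_
    rw [Finset.mul_sum, Finset.mul_sum]
  rw [hR]
  have hinj : Set.InjOn φ (Finset.Icc 1 N ×ˢ Finset.Icc 1 N : Finset (ℕ × ℕ)) := by
    rintro ⟨a, b⟩ _ ⟨c, d⟩ _ h
    simp only [φ, Prod.mk.injEq] at h
    obtain ⟨h1, h2, h3⟩ := h
    have ha := Nat.div_mul_cancel (Nat.gcd_dvd_left a b)
    have hb := Nat.div_mul_cancel (Nat.gcd_dvd_right a b)
    have hc := Nat.div_mul_cancel (Nat.gcd_dvd_left c d)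
    have hd := Nat.div_mul_cancel (Nat.gcd_dvd_right c d)
    rw [h2, h1] at ha
    rw [h3, h1] at hb
    ext
    · exact ha.symm.trans hc
    · exact hb.symm.trans hd
  have hval : ∀ p ∈ Finset.Icc 1 N ×ˢ Finset.Icc 1 N,
      (Nat.gcd p.1 p.2 : ℝ) / (p.1 * p.2) = F (φ p) := by
    rintro ⟨a, b⟩ h
    simp only [Finset.mem_product, Finset.mem_Icc] at h
    have hg : 0 < a.gcd b := Nat.gcd_pos_of_pos_left _ (by omega)
    have hg' : ((a.gcd b : ℕ) : ℝ) ≠ 0 := by positivity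
    have ha : (a : ℝ) ≠ 0 := by norm_cast; omega
    have hb : (b : ℝ) ≠ 0 := by norm_cast; omega
    simp only [F, φ]
    rw [Nat.cast_div (Nat.gcd_dvd_left a b) hg', Nat.cast_div (Nat.gcd_dvd_right a b) hg']
    field_simp
  rw [Finset.sum_congr rfl hval, ← Finset.sum_image (f := F) hinj]
  refine Finset.sum_le_sum_of_subset_of_nonneg ?_ fun q _ _ => by positivity
  intro q hq
  obtain ⟨⟨a, b⟩, h, rfl⟩ := Finset.mem_image.1 hq
  simp only [Finset.mem_product, Finset.mem_Icc] at h
  have hg : 0 < a.gcd b := Nat.gcd_pos_of_pos_left _ (by omega)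
  simp only [φ, Finset.mem_product, Finset.mem_Icc]
  have h1 := Nat.le_of_dvd (by omega) (Nat.gcd_dvd_left a b)
  have h2 := Nat.le_of_dvd (by omega) (Nat.gcd_dvd_right a b)
  have h3 := Nat.div_le_self a (a.gcd b)
  have h4 := Nat.div_le_self b (a.gcd b)
  have h5 := Nat.div_pos h1 hg
  have h6 := Nat.div_pos h2 hg
  omega

/-- The number of divisors of `m` in `[1, N]`. -/
def smallDivisorCount (N m : ℕ) : ℕ := ((Finset.Icc 1 N).filter (· ∣ m)).card

lemma sum_smallDivisorCount_sq_le (N X : ℕ) :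
    ∑ m ∈ Finset.Icc 1 X, (smallDivisorCount N m : ℝ) ^ 2 ≤ X * (1 + log N) ^ 3 := by
  have h1 : ∀ m, (smallDivisorCount N m : ℝ) ^ 2 =
      ∑ p ∈ Finset.Icc 1 N ×ˢ Finset.Icc 1 N, if p.1.lcm p.2 ∣ m then (1 : ℝ) else 0 := by
    intro m
    rw [smallDivisorCount, Finset.card_filter, Finset.sum_product, pow_two]
    push_cast
    rw [Finset.sum_mul]
    refine Finset.sum_congr rfl fun a _ => ?_
    rw [Finset.mul_sum]
    refine Finset.sum_congr rfl fun b _ => ?_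
    simp only [Nat.lcm_dvd_iff]
    split_ifs <;> simp_all
  simp_rw [h1]
  rw [Finset.sum_comm]
  have h2 : ∀ p ∈ Finset.Icc 1 N ×ˢ Finset.Icc 1 N,
      (∑ m ∈ Finset.Icc 1 X, if p.1.lcm p.2 ∣ m then (1 : ℝ) else 0) ≤
        X * ((Nat.gcd p.1 p.2 : ℝ) / (p.1 * p.2)) := by
    rintro ⟨a, b⟩ h
    simp only [Finset.mem_product, Finset.mem_Icc] at h
    have hcard : (∑ m ∈ Finset.Icc 1 X, if a.lcm b ∣ m then (1 : ℝ) else 0) =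
        ((X / a.lcm b : ℕ) : ℝ) := by
      rw [← Nat.Ioc_filter_dvd_card_eq_div, Finset.card_filter]
      push_cast
      rfl
    rw [hcard]
    refine Nat.cast_div_le.trans (le_of_eq ?_)
    have hl : (0 : ℝ) < (a.lcm b : ℕ) := by
      exact_mod_cast Nat.lcm_pos (by omega) (by omega)
    have hg : (a.gcd b : ℝ) * (a.lcm b : ℕ) = a * b := by exact_mod_cast Nat.gcd_mul_lcm a b
    have ha : (a : ℝ) ≠ 0 := by norm_cast; omega
    have hb : (b : ℝ) ≠ 0 := by norm_cast; omega
    have hg0 : (a.gcd b : ℝ) ≠ 0 := by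
      intro h0
      rw [h0, zero_mul] at hg
      exact mul_ne_zero ha hb hg.symm
    rw [← hg]
    field_simp
  refine (Finset.sum_le_sum h2).trans ?_
  rw [← Finset.mul_sum]
  refine mul_le_mul_of_nonneg_left ((sum_gcd_div_mul_le N).trans ?_) (by positivity)
  gcongr
  have := harmonic_le_one_add_log N
  rw [harmonic_eq_sum_Icc] at this
  push_cast at this
  simpa using this

lemma sum_natAbs_le (F : ℕ → ℝ) (hF : ∀ k, 0 ≤ F k) (S : Finset ℤ) (X : ℕ)
    (hS : ∀ n ∈ S, n.natAbs ∈ Finset.Icc 1 X) :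
    ∑ n ∈ S, F n.natAbs ≤ 2 * ∑ k ∈ Finset.Icc 1 X, F k := by
  rw [← Finset.sum_fiberwise_of_maps_to hS, Finset.mul_sum]
  refine Finset.sum_le_sum fun k _ => ?_
  have : ∀ n ∈ S.filter (fun n => n.natAbs = k), F n.natAbs = F k := fun n hn => by
    rw [(Finset.mem_filter.1 hn).2]
  rw [Finset.sum_congr rfl this, Finset.sum_const, nsmul_eq_mul]
  refine mul_le_mul_of_nonneg_right ?_ (hF k)
  have hsub : S.filter (fun n => n.natAbs = k) ⊆ {(k : ℤ), -(k : ℤ)} := by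
    intro n hn
    have := (Finset.mem_filter.1 hn).2
    simp only [Finset.mem_insert, Finset.mem_singleton]
    omega
  exact_mod_cast (Finset.card_le_card hsub).trans Finset.card_le_two

lemma norm_exp_I_mul_ofReal (θ : ℝ) : ‖Complex.exp (Complex.I * θ)‖ = 1 := by
  rw [mul_comm, Complex.norm_exp_ofReal_mul_I]

lemma exp_I_mul_add_period (x : ℝ) (hx : x ≠ 0) (n : ℤ) (β : ℝ) :
    Complex.exp (Complex.I * ((x * n * (β + 2 * π / |x|) : ℝ) : ℂ)) =
      Complex.exp (Complex.I * ((x * n * β : ℝ) : ℂ)) := by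
  rw [Complex.exp_eq_exp_iff_exists_int]
  rcases lt_or_gt_of_ne hx with h | h
  · refine ⟨-n, ?_⟩
    rw [abs_of_neg h]
    have : (x : ℂ) ≠ 0 := by exact_mod_cast hx
    push_cast
    field_simp
  · refine ⟨n, ?_⟩
    rw [abs_of_pos h]
    have : (x : ℂ) ≠ 0 := by exact_mod_cast hx
    push_cast
    field_simp

lemma integral_exp_period (x : ℝ) (hx : x ≠ 0) (n : ℤ) :
    ∫ β in (0 : ℝ)..(2 * π / |x|), Complex.exp (Complex.I * ((x * n * β : ℝ) : ℂ)) =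
      if n = 0 then ((2 * π / |x| : ℝ) : ℂ) else 0 := by
  split_ifs with h
  · simp [h]
  · have hc : Complex.I * x * n ≠ 0 := by
      simp [hx, h]
    have he := exp_I_mul_add_period x hx n 0
    have : ∀ β : ℝ, Complex.exp (Complex.I * ((x * n * β : ℝ) : ℂ)) =
        Complex.exp (Complex.I * x * n * β) := fun β => by push_cast; ring_nf
    rw [this, this, zero_add] at he
    simp_rw [this]
    rw [integral_exp_mul_complex hc, he, sub_self, zero_div]

lemma continuous_norm_sq_exp_sum {ι : Type*} (S : Finset ι) (c : ι → ℂ) (g : ι → ℝ) :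
    Continuous fun β : ℝ =>
      ‖∑ p ∈ S, c p * Complex.exp (Complex.I * ((g p * β : ℝ) : ℂ))‖ ^ 2 := by
  fun_prop

/-- Parseval's identity for a trigonometric polynomial over one period. -/
lemma integral_norm_sq_exp_sum_period (x : ℝ) (hx : x ≠ 0) (S : Finset ℤ) (b : ℤ → ℂ) :
    ∫ β in (0 : ℝ)..(2 * π / |x|),
      ‖∑ n ∈ S, b n * Complex.exp (Complex.I * ((x * n * β : ℝ) : ℂ))‖ ^ 2 =
      2 * π / |x| * ∑ n ∈ S, ‖b n‖ ^ 2 := by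
  have h1 : ∀ β : ℝ,
      ((‖∑ n ∈ S, b n * Complex.exp (Complex.I * ((x * n * β : ℝ) : ℂ))‖ ^ 2 : ℝ) : ℂ) =
      ∑ n ∈ S, ∑ m ∈ S, b n * (starRingEnd ℂ) (b m) *
        Complex.exp (Complex.I * ((x * (n - m : ℤ) * β : ℝ) : ℂ)) := by
    intro β
    push_cast
    rw [← Complex.mul_conj', map_sum, Finset.sum_mul_sum]
    refine Finset.sum_congr rfl fun n _ => Finset.sum_congr rfl fun m _ => ?_
    rw [map_mul, ← Complex.exp_conj, mul_mul_mul_comm, ← Complex.exp_add]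
    congr 2
    simp only [map_mul, Complex.conj_I, Complex.conj_ofReal, map_intCast]
    ring
  have h2 : ∀ n m : ℤ, IntervalIntegrable (fun β : ℝ => b n * (starRingEnd ℂ) (b m) *
        Complex.exp (Complex.I * ((x * (n - m : ℤ) * β : ℝ) : ℂ))) volume 0 (2 * π / |x|) :=
    fun n m => Continuous.intervalIntegrable (by fun_prop) _ _
  rw [← Complex.ofReal_inj, ← intervalIntegral.integral_ofReal]
  simp_rw [h1]
  rw [intervalIntegral.integral_finsetSum
    fun n _ => Continuous.intervalIntegrable (by fun_prop) _ _]
  rw [Complex.ofReal_mul, Complex.ofReal_sum, Finset.mul_sum]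
  refine Finset.sum_congr rfl fun n hn => ?_
  rw [intervalIntegral.integral_finsetSum fun m _ => h2 n m, Finset.sum_eq_single n]
  · rw [intervalIntegral.integral_const_mul, integral_exp_period x hx]
    simp only [sub_self, if_true]
    rw [Complex.mul_conj', mul_comm]
    push_cast
    rfl
  · intro m _ hmn
    rw [intervalIntegral.integral_const_mul, integral_exp_period x hx, if_neg (by omega), mul_zero]
  · exact fun h => absurd hn h

lemma integral_le_of_periodic (g : ℝ → ℝ) (hg : Continuous g) (hg0 : ∀ x, 0 ≤ g x) (P : ℝ)
    (hP : 0 < P) (hper : Function.Periodic g P) (T : ℝ) (hT : 0 < T) :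
    ∫ β in (-T)..T, g β ≤ (2 * T + P) / P * ∫ β in (0 : ℝ)..P, g β := by
  set n : ℤ := ⌈2 * T / P⌉
  have hn : 2 * T / P ≤ n := Int.le_ceil _
  have hn' : (n : ℝ) < 2 * T / P + 1 := Int.ceil_lt_add_one _
  have h2 : 2 * T ≤ n * P := by rwa [div_le_iff₀ hP] at hn
  have hint : ∀ a b, IntervalIntegrable g volume a b := fun a b => hg.intervalIntegrable a b
  have h0 : 0 ≤ ∫ β in (0 : ℝ)..P, g β :=
    intervalIntegral.integral_nonneg hP.le fun x _ => hg0 x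
  calc ∫ β in (-T)..T, g β ≤ ∫ β in (-T)..(-T + n • P), g β := by
        refine intervalIntegral.integral_mono_interval le_rfl (by linarith) ?_
          (Filter.Eventually.of_forall hg0) (hint _ _)
        rw [zsmul_eq_mul]; linarith
    _ = n * ∫ β in (0 : ℝ)..P, g β := by
        rw [hper.intervalIntegral_add_zsmul_eq n (-T) (hint), zsmul_eq_mul,
          hper.intervalIntegral_add_eq (-T) 0, zero_add]
    _ ≤ _ := by
        refine mul_le_mul_of_nonneg_right ?_ h0
        rw [add_div, div_self hP.ne']
        exact hn'.le

lemma integral_norm_sq_exp_sum_le {ι : Type*} (x : ℝ) (hx : x ≠ 0) (T : ℝ) (hT : 0 < T)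
    (S : Finset ι) (m : ι → ℤ) (c : ι → ℂ) :
    ∫ β in (-T)..T, ‖∑ p ∈ S, c p * Complex.exp (Complex.I * ((x * m p * β : ℝ) : ℂ))‖ ^ 2 ≤
      (2 * T + 2 * π / |x|) * ∑ n ∈ S.image m, ‖∑ p ∈ S with m p = n, c p‖ ^ 2 := by
  have hP : 0 < 2 * π / |x| := by positivity
  have hgroup : ∀ β : ℝ, ∑ p ∈ S, c p * Complex.exp (Complex.I * ((x * m p * β : ℝ) : ℂ)) =
      ∑ n ∈ S.image m, (∑ p ∈ S with m p = n, c p) *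
        Complex.exp (Complex.I * ((x * n * β : ℝ) : ℂ)) := by
    intro β
    rw [← Finset.sum_fiberwise_of_maps_to (fun p hp => Finset.mem_image_of_mem m hp)]
    refine Finset.sum_congr rfl fun n _ => ?_
    rw [Finset.sum_mul]
    refine Finset.sum_congr rfl fun p hp => ?_
    rw [(Finset.mem_filter.1 hp).2]
  simp_rw [hgroup]
  refine (integral_le_of_periodic _ (continuous_norm_sq_exp_sum _ _ _) (fun _ => by positivity)
    _ hP ?_ T hT).trans (le_of_eq ?_)
  · intro β
    simp only [exp_I_mul_add_period x hx]
  · rw [integral_norm_sq_exp_sum_period x hx]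
    field_simp

lemma integral_norm_sq_exp_sum_le_of_fiber {ι : Type*} (x : ℝ) (hx : x ≠ 0) (T : ℝ) (hT : 0 < T)
    (S : Finset ι) (s : ι → ℤ) (c : ι → ℂ) (r M : ℝ)
    (hr : ∀ q, ‖∑ p ∈ S with s p = q, c p‖ ≤ r) (hM : ((S.image s).card : ℝ) ≤ M) :
    ∫ α in (-T)..T, ‖∑ p ∈ S, c p * Complex.exp (Complex.I * ((x * s p * α : ℝ) : ℂ))‖ ^ 2 ≤
      (2 * T + 2 * π / |x|) * (M * r ^ 2) := by
  refine (integral_norm_sq_exp_sum_le x hx T hT S s c).trans ?_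
  refine mul_le_mul_of_nonneg_left ?_ (by positivity)
  calc ∑ q ∈ S.image s, ‖∑ p ∈ S with s p = q, c p‖ ^ 2 ≤ ∑ q ∈ S.image s, r ^ 2 :=
        Finset.sum_le_sum fun q _ => pow_le_pow_left₀ (norm_nonneg _) (hr q) 2
    _ = (S.image s).card * r ^ 2 := by rw [Finset.sum_const, nsmul_eq_mul]
    _ ≤ M * r ^ 2 := mul_le_mul_of_nonneg_right hM (by positivity)

lemma integral_norm_sq_exp_sum_le_trivial {ι : Type*} (x : ℝ) (T : ℝ) (hT : 0 < T)
    (S : Finset ι) (s : ι → ℤ) (c : ι → ℂ) (r M : ℝ)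
    (hr : ∀ q, ‖∑ p ∈ S with s p = q, c p‖ ≤ r) (hM : ((S.image s).card : ℝ) ≤ M) :
    ∫ α in (-T)..T, ‖∑ p ∈ S, c p * Complex.exp (Complex.I * ((x * s p * α : ℝ) : ℂ))‖ ^ 2 ≤
      2 * T * (M * r) ^ 2 := by
  have hr0 : 0 ≤ r := (norm_nonneg _).trans (hr 0)
  have hpt : ∀ α : ℝ,
      ‖∑ p ∈ S, c p * Complex.exp (Complex.I * ((x * s p * α : ℝ) : ℂ))‖ ≤ M * r := by
    intro α
    rw [← Finset.sum_fiberwise_of_maps_to (fun p hp => Finset.mem_image_of_mem s hp)]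
    calc _ ≤ ∑ q ∈ S.image s, r := by
          refine norm_sum_le_of_le _ fun q _ => ?_
          have : ∑ p ∈ S with s p = q,
              c p * Complex.exp (Complex.I * ((x * s p * α : ℝ) : ℂ)) =
              (∑ p ∈ S with s p = q, c p) *
                Complex.exp (Complex.I * ((x * q * α : ℝ) : ℂ)) := by
            rw [Finset.sum_mul]
            refine Finset.sum_congr rfl fun p hp => ?_
            rw [(Finset.mem_filter.1 hp).2]
          rw [this, norm_mul, norm_exp_I_mul_ofReal, mul_one]
          exact hr q
      _ = (S.image s).card * r := by rw [Finset.sum_const, nsmul_eq_mul]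
      _ ≤ M * r := mul_le_mul_of_nonneg_right hM hr0
  calc _ ≤ ∫ α in (-T)..T, (M * r) ^ 2 := by
        refine intervalIntegral.integral_mono (by linarith)
          ((continuous_norm_sq_exp_sum _ _ _).intervalIntegrable _ _)
          intervalIntegrable_const fun α => ?_
        exact pow_le_pow_left₀ (norm_nonneg _) (hpt α) 2
    _ = _ := by rw [intervalIntegral.integral_const, smul_eq_mul]; ring

/-- The index set of the off-diagonal terms `(ℓ, j, k)` with `0 < |ℓ| ≤ L` and `j ≠ k` in
`[1, N]`. -/
noncomputable def offDiag (L N : ℕ) : Finset (ℤ × ℕ × ℕ) :=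
  (Finset.Icc (-(L : ℤ)) L).filter (· ≠ 0) ×ˢ
    (Finset.Icc 1 N ×ˢ Finset.Icc 1 N).filter fun q => q.1 ≠ q.2

/-- The frequency in `β` of the term `(ℓ, j, k)`. -/
def freq (p : ℤ × ℕ × ℕ) : ℤ := p.1 * ((p.2.1 : ℤ) - p.2.2)

/-- The sum `j + k` of the term `(ℓ, j, k)`. -/
def idxSum (p : ℤ × ℕ × ℕ) : ℤ := (p.2.1 : ℤ) + p.2.2

lemma mem_offDiag {L N : ℕ} {p : ℤ × ℕ × ℕ} : p ∈ offDiag L N ↔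
    ((-(L : ℤ) ≤ p.1 ∧ p.1 ≤ L) ∧ p.1 ≠ 0) ∧
      ((1 ≤ p.2.1 ∧ p.2.1 ≤ N) ∧ 1 ≤ p.2.2 ∧ p.2.2 ≤ N) ∧ p.2.1 ≠ p.2.2 := by
  simp [offDiag]

lemma natAbs_freq_mem {L N : ℕ} {p : ℤ × ℕ × ℕ} (hp : p ∈ offDiag L N) :
    (freq p).natAbs ∈ Finset.Icc 1 (L * N) := by
  obtain ⟨⟨h1, h2⟩, ⟨h3, h4⟩, h5⟩ := mem_offDiag.1 hp
  rw [freq, Int.natAbs_mul, Finset.mem_Icc]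
  exact ⟨Nat.mul_pos (by omega) (by omega), Nat.mul_le_mul (by omega) (by omega)⟩

lemma card_fiber_le (L N : ℕ) (n q : ℤ) (hn : n ≠ 0) :
    (((offDiag L N).filter fun p => freq p = n).filter fun p => idxSum p = q).card ≤
      2 * smallDivisorCount N n.natAbs := by
  set A := (Finset.Icc 1 N).filter (· ∣ n.natAbs)
  have hcard : (A.image (fun d : ℕ => (d : ℤ)) ∪ A.image (fun d : ℕ => -(d : ℤ))).card ≤
      2 * smallDivisorCount N n.natAbs := by
    refine (Finset.card_union_le _ _).trans ?_
    rw [two_mul]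
    exact add_le_add Finset.card_image_le Finset.card_image_le
  refine le_trans ?_ hcard
  refine Finset.card_le_card_of_injOn (fun p => (p.2.1 : ℤ) - p.2.2) ?_ ?_
  · intro p hp
    simp only [Finset.coe_filter, Finset.mem_filter, Set.mem_ofPred_eq] at hp
    obtain ⟨⟨hp, hf⟩, -⟩ := hp
    obtain ⟨-, h4, h5⟩ := mem_offDiag.1 hp
    have hd : ((p.2.1 : ℤ) - p.2.2).natAbs ∈ A := by
      refine Finset.mem_filter.2 ⟨Finset.mem_Icc.2 (by omega), ?_⟩
      rw [← hf, freq, Int.natAbs_mul]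
      exact dvd_mul_left _ _
    simp only [Finset.coe_union, Finset.coe_image, Set.mem_union, Set.mem_image, Finset.mem_coe]
    rcases Int.natAbs_eq ((p.2.1 : ℤ) - p.2.2) with h | h
    · exact Or.inl ⟨_, hd, h.symm⟩
    · exact Or.inr ⟨_, hd, h.symm⟩
  · rintro ⟨ℓ, j, k⟩ hp ⟨ℓ', j', k'⟩ hp' hd
    simp only [Finset.mem_coe, Finset.mem_filter] at hp hp' hd
    simp only [freq, idxSum] at hp hp'
    have hj : j = j' := by omega
    have hk : k = k' := by omega
    subst hj hk
    have hne : (j : ℤ) - k ≠ 0 := fun h => hn (by rw [← hp.1.2, h, mul_zero])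
    have := mul_right_cancel₀ hne (hp.1.2.trans hp'.1.2.symm)
    rw [this]

lemma card_image_idxSum_le (L N : ℕ) (n : ℤ) :
    ((((offDiag L N).filter fun p => freq p = n).image idxSum).card : ℝ) ≤ 2 * N := by
  have hsub : ((offDiag L N).filter fun p => freq p = n).image idxSum ⊆
      Finset.Icc 1 (2 * N : ℤ) := by
    intro q hq
    obtain ⟨p, hp, rfl⟩ := Finset.mem_image.1 hq
    obtain ⟨-, h4, h5⟩ := mem_offDiag.1 (Finset.mem_filter.1 hp).1
    rw [idxSum, Finset.mem_Icc]
    omega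
  have := Finset.card_le_card hsub
  rw [Int.card_Icc] at this
  have h2 : (((offDiag L N).filter fun p => freq p = n).image idxSum).card ≤ 2 * N := by omega
  exact_mod_cast h2

/-- Mean square in `α` of the coefficient of a single frequency `n` in `β`. -/
lemma integral_norm_sq_coeff_le (t : ℝ) (ht : t ≠ 0) (T : ℝ) (hT : 0 < T) (B : ℝ)
    (L N : ℕ) (hN : 0 < N) (a : ℤ → ℂ) (ha : ∀ ℓ, ‖a ℓ‖ ≤ B) (n : ℤ) (hn : n ≠ 0) :
    ∫ α in (-T)..T, ‖∑ p ∈ offDiag L N with freq p = n,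
        a p.1 * Complex.exp (Complex.I * ((t * n / N * idxSum p * α : ℝ) : ℂ))‖ ^ 2 ≤
      (32 * T + 16 * π / |t|) * B ^ 2 *
        ((N + if n.natAbs ≤ N then (N : ℝ) ^ 2 else 0) *
          (smallDivisorCount N n.natAbs : ℝ) ^ 2) := by
  have hB : 0 ≤ B := (norm_nonneg _).trans (ha 0)
  have hN' : (0 : ℝ) < N := by exact_mod_cast hN
  have hn' : (n : ℝ) ≠ 0 := by exact_mod_cast hn
  set τ : ℝ := (smallDivisorCount N n.natAbs : ℝ)
  have ht0 : 0 < |t| := abs_pos.2 ht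
  have hr : ∀ q, ‖∑ p ∈ (offDiag L N).filter (fun p => freq p = n) with idxSum p = q, a p.1‖ ≤
      2 * τ * B := by
    intro q
    calc _ ≤ ∑ p ∈ (offDiag L N).filter (fun p => freq p = n) with idxSum p = q, B :=
          norm_sum_le_of_le _ fun p _ => ha p.1
      _ ≤ 2 * τ * B := by
          rw [Finset.sum_const, nsmul_eq_mul]
          refine mul_le_mul_of_nonneg_right ?_ hB
          have := card_fiber_le L N n q hn
          simp only [τ]
          exact_mod_cast this
  have hpi : 0 ≤ π / |t| := by positivity
  split_ifs with h
  · refine (integral_norm_sq_exp_sum_le_trivial _ T hT _ idxSum _ _ _ hr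
      (card_image_idxSum_le L N n)).trans ?_
    have h1 : 0 ≤ B ^ 2 * τ ^ 2 := by positivity
    have h2 : 0 ≤ 16 * π / |t| := by positivity
    calc 2 * T * (2 * N * (2 * τ * B)) ^ 2 = (32 * T + 0) * B ^ 2 * ((0 + N ^ 2) * τ ^ 2) := by
          ring
      _ ≤ _ := by gcongr
  · have hx : |t| ≤ |t * n / N| := by
      rw [abs_div, abs_mul, Nat.abs_cast, le_div_iff₀ hN']
      refine mul_le_mul_of_nonneg_left ?_ ht0.le
      have : (N : ℤ) ≤ |n| := by
        rw [Int.abs_eq_natAbs]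
        omega
      exact_mod_cast this
    refine (integral_norm_sq_exp_sum_le_of_fiber _ (abs_pos.1 (ht0.trans_le hx)) T hT _ idxSum
      _ _ _ hr (card_image_idxSum_le L N n)).trans ?_
    have h1 : 0 ≤ T * N * B ^ 2 * τ ^ 2 := by positivity
    calc _ ≤ (2 * T + 2 * π / |t|) * (2 * N * (2 * τ * B) ^ 2) := by gcongr
      _ = (16 * T + 16 * π / |t|) * B ^ 2 * ((N + 0) * τ ^ 2) := by ring
      _ ≤ _ := by
          gcongr
          norm_num

lemma sum_weighted_smallDivisorCount_le (R N : ℕ) (S : Finset ℤ)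
    (hS : ∀ n ∈ S, n.natAbs ∈ Finset.Icc 1 (R * N * N)) :
    ∑ n ∈ S, (N + if n.natAbs ≤ N then (N : ℝ) ^ 2 else 0) *
        (smallDivisorCount N n.natAbs : ℝ) ^ 2 ≤
      (2 * R + 2) * N ^ 3 * (1 + log N) ^ 3 := by
  have h1 : ∑ n ∈ S, (N : ℝ) * (smallDivisorCount N n.natAbs : ℝ) ^ 2 ≤
      N * (2 * ((R * N * N : ℕ) * (1 + log N) ^ 3)) := by
    rw [← Finset.mul_sum]
    refine mul_le_mul_of_nonneg_left ?_ (Nat.cast_nonneg _)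
    refine (sum_natAbs_le (fun k => (smallDivisorCount N k : ℝ) ^ 2) (fun _ => by positivity)
      S _ hS).trans ?_
    exact mul_le_mul_of_nonneg_left (sum_smallDivisorCount_sq_le _ _) two_pos.le
  have h2 : ∑ n ∈ S with n.natAbs ≤ N, (N : ℝ) ^ 2 * (smallDivisorCount N n.natAbs : ℝ) ^ 2 ≤
      N ^ 2 * (2 * (N * (1 + log N) ^ 3)) := by
    rw [← Finset.mul_sum]
    refine mul_le_mul_of_nonneg_left ?_ (by positivity)
    refine (sum_natAbs_le (fun k => (smallDivisorCount N k : ℝ) ^ 2) (fun _ => by positivity)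
      _ N fun n hn => ?_).trans ?_
    · obtain ⟨hn, hle⟩ := Finset.mem_filter.1 hn
      exact Finset.mem_Icc.2 ⟨(Finset.mem_Icc.1 (hS n hn)).1, hle⟩
    · exact mul_le_mul_of_nonneg_left (sum_smallDivisorCount_sq_le _ _) two_pos.le
  rw [Finset.sum_filter] at h2
  calc _ = ∑ n ∈ S, (N : ℝ) * (smallDivisorCount N n.natAbs : ℝ) ^ 2 +
        ∑ n ∈ S, (if n.natAbs ≤ N then (N : ℝ) ^ 2 * (smallDivisorCount N n.natAbs : ℝ) ^ 2
          else 0) := by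
        rw [← Finset.sum_add_distrib]
        refine Finset.sum_congr rfl fun n _ => ?_
        split_ifs <;> ring
    _ ≤ _ := add_le_add h1 h2
    _ = _ := by push_cast; ring

/-- The off-diagonal part of the pair correlation sum. -/
noncomputable def offDiagSum (t : ℝ) (L N : ℕ) (a : ℤ → ℂ) (α β : ℝ) : ℂ :=
  ∑ p ∈ offDiag L N, a p.1 * Complex.exp (Complex.I *
    ((t * freq p / N * idxSum p * α : ℝ) : ℂ)) *
      Complex.exp (Complex.I * ((t * freq p * β : ℝ) : ℂ))

lemma continuous_offDiagSum (t : ℝ) (L N : ℕ) (a : ℤ → ℂ) :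
    Continuous fun p : ℝ × ℝ => offDiagSum t L N a p.1 p.2 := by
  unfold offDiagSum
  fun_prop

lemma integral_norm_sq_offDiagSum_le (t : ℝ) (ht : t ≠ 0) (T : ℝ) (hT : 0 < T) (B : ℝ) (R : ℕ)
    (N : ℕ) (hN : 0 < N) (a : ℤ → ℂ) (ha : ∀ ℓ, ‖a ℓ‖ ≤ B) :
    ∫ α in (-T)..T, ∫ β in (-T)..T, ‖offDiagSum t (R * N) N a α β‖ ^ 2 ≤
      (2 * T + 2 * π / |t|) * ((32 * T + 16 * π / |t|) * B ^ 2 *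
        ((2 * R + 2) * N ^ 3 * (1 + log N) ^ 3)) := by
  have hmem : ∀ n ∈ (offDiag (R * N) N).image freq, n.natAbs ∈ Finset.Icc 1 (R * N * N) := by
    intro n hn
    obtain ⟨p, hp, rfl⟩ := Finset.mem_image.1 hn
    exact natAbs_freq_mem hp
  have hcoeff : ∀ (α : ℝ) (n : ℤ), ∑ p ∈ offDiag (R * N) N with freq p = n,
      a p.1 * Complex.exp (Complex.I * ((t * freq p / N * idxSum p * α : ℝ) : ℂ)) =
      ∑ p ∈ offDiag (R * N) N with freq p = n,
        a p.1 * Complex.exp (Complex.I * ((t * n / N * idxSum p * α : ℝ) : ℂ)) :=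
    fun α n => Finset.sum_congr rfl fun p hp => by rw [(Finset.mem_filter.1 hp).2]
  have hcont : ∀ n : ℤ, Continuous fun α : ℝ => ‖∑ p ∈ offDiag (R * N) N with freq p = n,
      a p.1 * Complex.exp (Complex.I * ((t * n / N * idxSum p * α : ℝ) : ℂ))‖ ^ 2 :=
    fun n => continuous_norm_sq_exp_sum _ _ _
  calc _ ≤ ∫ α in (-T)..T, (2 * T + 2 * π / |t|) * ∑ n ∈ (offDiag (R * N) N).image freq,
        ‖∑ p ∈ offDiag (R * N) N with freq p = n,
          a p.1 * Complex.exp (Complex.I * ((t * n / N * idxSum p * α : ℝ) : ℂ))‖ ^ 2 := by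
        refine intervalIntegral.integral_mono (by linarith)
          (Continuous.intervalIntegrable ?_ _ _) (Continuous.intervalIntegrable ?_ _ _) fun α => ?_
        · exact intervalIntegral.continuous_parametric_intervalIntegral_of_continuous'
            ((continuous_offDiagSum t (R * N) N a).norm.pow 2) _ _
        · exact continuous_const.mul (continuous_finsetSum _ fun n _ => hcont n)
        · simp_rw [← hcoeff]
          exact integral_norm_sq_exp_sum_le t ht T hT _ freq _
    _ = (2 * T + 2 * π / |t|) * ∑ n ∈ (offDiag (R * N) N).image freq, ∫ α in (-T)..T,
        ‖∑ p ∈ offDiag (R * N) N with freq p = n,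
          a p.1 * Complex.exp (Complex.I * ((t * n / N * idxSum p * α : ℝ) : ℂ))‖ ^ 2 := by
        rw [intervalIntegral.integral_const_mul, intervalIntegral.integral_finsetSum
          fun n _ => (hcont n).intervalIntegrable _ _]
    _ ≤ _ := by
        refine mul_le_mul_of_nonneg_left ?_ (by positivity)
        refine (Finset.sum_le_sum fun n hn => integral_norm_sq_coeff_le t ht T hT B (R * N) N hN a
          ha n ?_).trans ?_
        · have := Finset.mem_Icc.1 (hmem n hn)
          omega
        · rw [← Finset.mul_sum]
          exact mul_le_mul_of_nonneg_left
            (sum_weighted_smallDivisorCount_le R N _ hmem) (by positivity)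

open FourierTransform in
lemma fourier_comp_mul_eq_FT (f : ℝ → ℝ) (R : ℝ) (hR : 0 < R) (w : ℝ) :
    𝓕 (fun x : ℝ => (f (R * x) : ℂ)) w = ((1 / R : ℝ) : ℂ) * FT f (2 * π * w / R) := by
  rw [Real.fourier_real_eq_integral_exp_smul, FT]
  have h := Measure.integral_comp_mul_left (fun y : ℝ =>
    (f y : ℂ) * Complex.exp (-(Complex.I * y * (2 * π * w / R : ℝ)))) R
  rw [abs_of_pos (inv_pos.2 hR), Complex.real_smul] at h
  rw [one_div, ← h]
  refine integral_congr_ae (Eventually.of_forall fun x => ?_)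
  simp only [smul_eq_mul]
  rw [mul_comm]
  congr 2
  have : (R : ℂ) ≠ 0 := by exact_mod_cast hR.ne'
  push_cast
  field_simp

lemma FT_eq_zero_of_compactSupport (f : ℝ → ℝ) (hf : HasCompactSupport (FT f)) :
    ∃ R : ℕ, ∀ N : ℕ, 0 < N → ∀ ℓ : ℤ, ℓ ∉ Finset.Icc (-((R * N : ℕ) : ℤ)) (R * N : ℕ) →
      FT f (2 * π * ℓ / N) = 0 := by
  obtain ⟨r, hr⟩ := hf.isCompact.isBounded.subset_closedBall 0
  refine ⟨⌈r⌉₊ + 1, fun N hN ℓ hℓ => ?_⟩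
  by_contra hne
  have hmem := hr (subset_tsupport _ hne)
  rw [Metric.mem_closedBall, dist_zero_right, Real.norm_eq_abs, abs_div, abs_mul,
    Nat.abs_cast, abs_of_pos (by positivity : 0 < 2 * π)] at hmem
  have hN' : (0 : ℝ) < N := by exact_mod_cast hN
  rw [div_le_iff₀ hN'] at hmem
  have h1 : |(ℓ : ℝ)| ≤ 2 * π * |(ℓ : ℝ)| :=
    le_mul_of_one_le_left (abs_nonneg _) (by linarith [Real.pi_gt_three])
  have h2 : r ≤ (⌈r⌉₊ + 1 : ℕ) := (Nat.le_ceil r).trans (by push_cast; linarith)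
  have h3 : |(ℓ : ℝ)| ≤ ((⌈r⌉₊ + 1) * N : ℕ) := by
    rw [Nat.cast_mul]
    exact (h1.trans hmem).trans (mul_le_mul_of_nonneg_right h2 hN'.le)
  have h4 : |ℓ| ≤ (((⌈r⌉₊ + 1) * N : ℕ) : ℤ) := by exact_mod_cast h3
  exact hℓ (Finset.mem_Icc.2 (abs_le.1 h4))

lemma norm_FT_le (f : ℝ → ℝ) (ξ : ℝ) : ‖FT f ξ‖ ≤ ∫ x, |f x| := by
  refine (norm_integral_le_integral_norm _).trans (le_of_eq ?_)
  refine integral_congr_ae (Eventually.of_forall fun x => ?_)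
  have : -(Complex.I * x * ξ) = ((-(x * ξ) : ℝ) : ℂ) * Complex.I := by push_cast; ring
  simp only [norm_mul, this, Complex.norm_exp_ofReal_mul_I, mul_one, Complex.norm_real,
    Real.norm_eq_abs]

/-- The Riemann sum of a compactly supported Fourier transform differs from the value at `0`
by `O(1 / N)`. -/
lemma norm_sum_FT_sub_le (f : SchwartzMap ℝ ℝ) (hf : HasCompactSupport (FT f)) :
    ∃ C : ℝ, ∀ N : ℕ, 0 < N →
      ‖((1 / N : ℝ) : ℂ) * (∑' ℓ : ℤ, FT f (2 * π * ℓ / N)) - (f 0 : ℂ)‖ ≤ C / N := by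
  obtain ⟨C, hC0, hC⟩ := f.decay 2 0
  simp only [norm_iteratedFDeriv_zero, Real.norm_eq_abs, sq_abs] at hC
  obtain ⟨R, hRz⟩ := FT_eq_zero_of_compactSupport f hf
  have hsum : Summable fun n : ℤ => 1 / (n : ℝ) ^ 2 :=
    Real.summable_one_div_int_pow.2 one_lt_two
  refine ⟨C * ∑' n : ℤ, 1 / (n : ℝ) ^ 2, fun N hN => ?_⟩
  have hN' : (0 : ℝ) < N := by exact_mod_cast hN
  have hN1 : (1 : ℝ) ≤ N := by exact_mod_cast hN
  set g : ℝ → ℂ := fun x => (f (N * x) : ℂ)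
  have hgc : Continuous g := by
    have := f.continuous
    fun_prop
  have hgd : ∀ x : ℝ, x ≠ 0 → ‖g x‖ ≤ C / N * (1 / x ^ 2) := fun x hx => by
    have h := hC (N * x)
    have hx2 : 0 < x ^ 2 := by positivity
    simp only [g, Complex.norm_real, Real.norm_eq_abs]
    rw [div_mul_div_comm, mul_one, le_div_iff₀ (by positivity)]
    refine le_trans ?_ h
    rw [mul_comm, mul_pow]
    refine mul_le_mul_of_nonneg_right (mul_le_mul_of_nonneg_right ?_ hx2.le) (abs_nonneg _)
    nlinarith
  have hgO : g =O[cocompact ℝ] fun x : ℝ => |x| ^ (-(2 : ℝ)) := by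
    refine Asymptotics.IsBigO.of_bound (C / N) ?_
    have : ∀ᶠ x in cocompact ℝ, x ≠ (0 : ℝ) :=
      (isCompact_singleton.compl_mem_cocompact : ({0} : Set ℝ)ᶜ ∈ _)
    filter_upwards [this] with x hx
    refine (hgd x hx).trans (le_of_eq ?_)
    rw [Real.rpow_neg (abs_nonneg x), Real.rpow_two, sq_abs, Real.norm_of_nonneg (by positivity),
      one_div]
  have hF : ∀ n : ℤ, FourierTransform.fourier g (n : ℝ) =
      ((1 / N : ℝ) : ℂ) * FT f (2 * π * n / N) := fun n => fourier_comp_mul_eq_FT f N hN' n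
  have hFs : Summable fun n : ℤ => FourierTransform.fourier g (n : ℝ) := by
    refine summable_of_ne_finset_zero (s := Finset.Icc (-((R * N : ℕ) : ℤ)) (R * N : ℕ))
      fun n hn => ?_
    rw [hF, hRz N hN n hn, mul_zero]
  have hP := Real.tsum_eq_tsum_fourier_of_rpow_decay_of_summable hgc one_lt_two hgO hFs 0
  simp only [zero_add, hF, QuotientAddGroup.mk_zero, fourier_eval_zero, mul_one, tsum_mul_left]
    at hP
  rw [← hP]
  have hgn : ∀ n : ℤ, ‖if n = 0 then 0 else g n‖ ≤ C / N * (1 / (n : ℝ) ^ 2) := fun n => by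
    split_ifs with h
    · rw [norm_zero]; positivity
    · exact hgd n (by exact_mod_cast h)
  have hgs' : Summable fun n : ℤ => if n = 0 then 0 else g n :=
    Summable.of_norm_bounded (hsum.mul_left _) hgn
  have hgs : Summable fun n : ℤ => g n := by
    refine (hgs'.add (summable_of_ne_finset_zero (s := {0})
      (f := fun n : ℤ => if n = 0 then g n else 0) fun n hn => ?_)).congr fun n => ?_
    · rw [if_neg (by simpa using hn)]
    · split_ifs <;> simp
  rw [hgs.tsum_eq_add_tsum_ite 0]
  have h0 : g ((0 : ℤ) : ℝ) = f 0 := by simp [g]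
  rw [h0, add_sub_cancel_left]
  calc _ ≤ ∑' n : ℤ, C / N * (1 / (n : ℝ) ^ 2) :=
        tsum_of_norm_bounded (hsum.mul_left _).hasSum hgn
    _ = _ := by rw [tsum_mul_left]; ring

lemma norm_sq_expSum_eq (t α β : ℝ) (N : ℕ) (ℓ : ℤ) :
    ((‖∑ j ∈ Finset.Icc 1 N, Complex.exp (Complex.I *
        ((t * ℓ * (α * (j : ℝ) ^ 2 / N + β * j) : ℝ) : ℂ))‖ ^ 2 : ℝ) : ℂ) =
      N + ∑ q ∈ (Finset.Icc 1 N ×ˢ Finset.Icc 1 N).filter (fun q => q.1 ≠ q.2),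
        Complex.exp (Complex.I * ((t * freq (ℓ, q) / N * idxSum (ℓ, q) * α : ℝ) : ℂ)) *
          Complex.exp (Complex.I * ((t * freq (ℓ, q) * β : ℝ) : ℂ)) := by
  have hpair : ∀ q : ℕ × ℕ,
      Complex.exp (Complex.I * ((t * freq (ℓ, q) / N * idxSum (ℓ, q) * α : ℝ) : ℂ)) *
          Complex.exp (Complex.I * ((t * freq (ℓ, q) * β : ℝ) : ℂ)) =
      Complex.exp (Complex.I * ((t * ℓ * (α * (q.1 : ℝ) ^ 2 / N + β * q.1) : ℝ) : ℂ)) *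
        (starRingEnd ℂ) (Complex.exp (Complex.I *
          ((t * ℓ * (α * (q.2 : ℝ) ^ 2 / N + β * q.2) : ℝ) : ℂ))) := by
    intro q
    rw [← Complex.exp_conj, ← Complex.exp_add, ← Complex.exp_add, map_mul, Complex.conj_I,
      Complex.conj_ofReal, freq, idxSum]
    congr 1
    push_cast
    ring
  have hdiag : ∑ q ∈ (Finset.Icc 1 N ×ˢ Finset.Icc 1 N).filter (fun q => ¬ q.1 ≠ q.2),
      Complex.exp (Complex.I * ((t * ℓ * (α * (q.1 : ℝ) ^ 2 / N + β * q.1) : ℝ) : ℂ)) *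
        (starRingEnd ℂ) (Complex.exp (Complex.I *
          ((t * ℓ * (α * (q.2 : ℝ) ^ 2 / N + β * q.2) : ℝ) : ℂ))) = N := by
    rw [Finset.sum_congr rfl (g := fun _ => (1 : ℂ)) fun q hq => ?_]
    · rw [Finset.sum_const, nsmul_eq_mul, mul_one, Nat.cast_inj]
      simp only [ne_eq, not_not]
      have : (Finset.Icc 1 N ×ˢ Finset.Icc 1 N).filter (fun q => q.1 = q.2) =
          (Finset.Icc 1 N).diag := by
        ext q
        simp only [Finset.mem_filter, Finset.mem_product, Finset.mem_diag]
        grind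
      rw [this, Finset.diag_card, Nat.card_Icc, Nat.add_sub_cancel]
    · rw [not_not.1 (Finset.mem_filter.1 hq).2, Complex.mul_conj', norm_exp_I_mul_ofReal]
      norm_num
  simp_rw [hpair]
  rw [← hdiag, add_comm, Finset.sum_filter_add_sum_filter_not, Finset.sum_product]
  push_cast
  rw [← Complex.mul_conj', map_sum, Finset.sum_mul_sum]

lemma card_offDiag_pairs (N : ℕ) :
    ((((Finset.Icc 1 N ×ˢ Finset.Icc 1 N).filter fun q => q.1 ≠ q.2).card : ℕ) : ℂ) =
      (N : ℂ) ^ 2 - N := by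
  have : (Finset.Icc 1 N ×ˢ Finset.Icc 1 N).filter (fun q => q.1 ≠ q.2) =
      (Finset.Icc 1 N).offDiag := by
    ext q
    simp only [Finset.mem_filter, Finset.mem_product, Finset.mem_offDiag, and_assoc]
  rw [this, Finset.offDiag_card, Nat.card_Icc, Nat.add_sub_cancel, Nat.cast_sub (Nat.le_mul_self N)]
  push_cast
  ring

/-- Splitting of the pair correlation sum into its diagonal part and its off-diagonal part. -/
lemma tsum_pairCorrelation_eq (t α β : ℝ) (L N : ℕ) (a : ℤ → ℂ)
    (ha : ∀ ℓ ∉ Finset.Icc (-(L : ℤ)) L, a ℓ = 0) :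
    ∑' ℓ : ℤ, a ℓ * ((‖∑ j ∈ Finset.Icc 1 N, Complex.exp (Complex.I *
        ((t * ℓ * (α * (j : ℝ) ^ 2 / N + β * j) : ℝ) : ℂ))‖ ^ 2 : ℝ) : ℂ) =
      N * ∑' ℓ : ℤ, a ℓ + a 0 * ((N : ℂ) ^ 2 - N) + offDiagSum t L N a α β := by
  rw [tsum_eq_sum (s := Finset.Icc (-(L : ℤ)) L) fun ℓ hℓ => by rw [ha ℓ hℓ, zero_mul],
    tsum_eq_sum ha]
  simp_rw [norm_sq_expSum_eq, mul_add]
  rw [Finset.sum_add_distrib, ← Finset.sum_mul, mul_comm, add_assoc]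
  congr 1
  rw [← Finset.sum_filter_add_sum_filter_not _ (fun ℓ : ℤ => ℓ ≠ 0), add_comm]
  congr 1
  · have : (Finset.Icc (-(L : ℤ)) L).filter (fun ℓ => ¬ ℓ ≠ 0) = {0} := by
      ext ℓ
      simp only [Finset.mem_filter, Finset.mem_Icc, Finset.mem_singleton]
      omega
    rw [this, Finset.sum_singleton, ← card_offDiag_pairs]
    simp [freq]
  · rw [offDiagSum, offDiag, Finset.sum_product]
    refine Finset.sum_congr rfl fun ℓ _ => ?_
    rw [Finset.mul_sum]
    exact Finset.sum_congr rfl fun q _ => (mul_assoc _ _ _).symm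

lemma one_half_le_log (N : ℕ) (hN : 2 ≤ N) : 1 / 2 ≤ Real.log N := by
  have h : Real.log 2 ≤ Real.log N := Real.log_le_log two_pos (by exact_mod_cast hN)
  linarith [Real.log_two_gt_d9]

lemma integral_norm_sq_add_le (T : ℝ) (hT : 0 < T) (V : ℝ → ℝ → ℂ)
    (hV : Continuous fun p : ℝ × ℝ => V p.1 p.2) (D : ℂ) (E : ℝ) (hD : ‖D‖ ≤ E) (c : ℝ) :
    ∫ α in (-T)..T, ∫ β in (-T)..T, ‖D + (c : ℂ) * V α β‖ ^ 2 ≤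
      (2 * T) ^ 2 * (2 * E ^ 2) +
        2 * c ^ 2 * ∫ α in (-T)..T, ∫ β in (-T)..T, ‖V α β‖ ^ 2 := by
  have hTT : -T ≤ T := by linarith
  have hV2 : Continuous fun p : ℝ × ℝ => ‖V p.1 p.2‖ ^ 2 := by fun_prop
  have hDV2 : Continuous fun p : ℝ × ℝ => ‖D + (c : ℂ) * V p.1 p.2‖ ^ 2 := by fun_prop
  have hVβ : ∀ α, Continuous fun β => V α β := fun α =>
    hV.comp (Continuous.prodMk_right α)
  have hVα : Continuous fun α => ∫ β in (-T)..T, ‖V α β‖ ^ 2 :=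
    intervalIntegral.continuous_parametric_intervalIntegral_of_continuous'
      (f := fun α β => ‖V α β‖ ^ 2) hV2 _ _
  have hpt : ∀ α β : ℝ, ‖D + (c : ℂ) * V α β‖ ^ 2 ≤ 2 * E ^ 2 + 2 * c ^ 2 * ‖V α β‖ ^ 2 := by
    intro α β
    have h1 : ‖D + (c : ℂ) * V α β‖ ≤ E + |c| * ‖V α β‖ := by
      refine (norm_add_le _ _).trans (add_le_add hD (le_of_eq ?_))
      rw [norm_mul, Complex.norm_real, Real.norm_eq_abs]
    calc _ ≤ (E + |c| * ‖V α β‖) ^ 2 := pow_le_pow_left₀ (norm_nonneg _) h1 2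
      _ ≤ 2 * (E ^ 2 + (|c| * ‖V α β‖) ^ 2) := add_sq_le
      _ = _ := by rw [mul_pow, sq_abs]; ring
  calc _ ≤ ∫ α in (-T)..T,
        (2 * T * (2 * E ^ 2) + 2 * c ^ 2 * ∫ β in (-T)..T, ‖V α β‖ ^ 2) := by
        refine intervalIntegral.integral_mono hTT (Continuous.intervalIntegrable ?_ _ _)
          (Continuous.intervalIntegrable (continuous_const.add (continuous_const.mul hVα)) _ _)
          fun α => ?_
        · exact intervalIntegral.continuous_parametric_intervalIntegral_of_continuous'
            (f := fun α β => ‖D + (c : ℂ) * V α β‖ ^ 2) hDV2 _ _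
        · have hVi : IntervalIntegrable (fun β => ‖V α β‖ ^ 2) volume (-T) T :=
            ((hVβ α).norm.pow 2).intervalIntegrable _ _
          refine (intervalIntegral.integral_mono hTT
            (((continuous_const.add (continuous_const.mul (hVβ α))).norm.pow 2).intervalIntegrable
              _ _) (intervalIntegrable_const.add (hVi.const_mul _)) fun β => hpt α β).trans
                (le_of_eq ?_)
          rw [intervalIntegral.integral_add intervalIntegrable_const (hVi.const_mul _),
            intervalIntegral.integral_const, intervalIntegral.integral_const_mul, smul_eq_mul]
          ring
    _ = _ := by
        rw [intervalIntegral.integral_add intervalIntegrable_const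
          ((hVα.intervalIntegrable _ _).const_mul _), intervalIntegral.integral_const,
          intervalIntegral.integral_const_mul, smul_eq_mul]
        ring

/-- Zelditch, Theorem 5.0.1 (Theorem B(b), quadratic case): for the family of quadratic
Hamiltonians `Ĥ_{α,β} = α Î² + β Î`, the variance over `(α,β)` of the pair correlation
functional `ρ^{(N)}_{t,α,β}(f)` around the Poisson limit `f(0) + f̂(0)` is
`O((log N)³/N)`. -/
theorem variance_pair_correlation_quadratic
    (t : ℝ) (ht : t ≠ 0) (T : ℝ) (hT : 0 < T)
    (f : SchwartzMap ℝ ℝ) (hf : HasCompactSupport (FT f)) :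
    ∃ C : ℝ, ∀ N : ℕ, 2 ≤ N →
      (1 / (2 * T) ^ 2) * (∫ α in (-T)..T, ∫ β in (-T)..T,
        ‖((1 / (N : ℝ) ^ 2 : ℝ) : ℂ) * (∑' ℓ : ℤ, FT f (2 * π * ℓ / N) *
            ((‖∑ j ∈ Finset.Icc 1 N, Complex.exp (Complex.I *
                ((t * ℓ * (α * (j : ℝ) ^ 2 / N + β * j) : ℝ) : ℂ))‖ ^ 2 : ℝ) : ℂ))
          - ((f 0 : ℂ) + FT f 0)‖ ^ 2)
        ≤ C * (Real.log N) ^ 3 / N := by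
  obtain ⟨R, hRz⟩ := FT_eq_zero_of_compactSupport f hf
  obtain ⟨C₀, hC₀⟩ := norm_sum_FT_sub_le f hf
  set B : ℝ := ∫ x, |f x|
  have hB : ∀ ξ, ‖FT f ξ‖ ≤ B := norm_FT_le f
  set C₁ : ℝ := C₀ + B
  set K : ℝ := (2 * T + 2 * π / |t|) * ((32 * T + 16 * π / |t|) * B ^ 2 * (2 * R + 2))
  have hK : 0 ≤ K := by positivity
  refine ⟨16 * C₁ ^ 2 + 54 * K / (2 * T) ^ 2, fun N hN => ?_⟩
  have hN0 : 0 < N := by omega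
  have hN' : (0 : ℝ) < N := by exact_mod_cast hN0
  have hN1 : (1 : ℝ) ≤ N := by exact_mod_cast hN0
  have hlog := one_half_le_log N hN
  set a : ℤ → ℂ := fun ℓ => FT f (2 * π * ℓ / N)
  set V : ℝ → ℝ → ℂ := offDiagSum t (R * N) N a
  set D : ℂ := ((1 / N : ℝ) : ℂ) * (∑' ℓ : ℤ, a ℓ) - (f 0 : ℂ) - FT f 0 / N
  have ha0 : a 0 = FT f 0 := by simp [a]
  have hD : ‖D‖ ≤ C₁ / N := by
    refine (norm_sub_le _ _).trans ?_
    rw [add_div]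
    refine add_le_add (hC₀ N hN0) ?_
    rw [norm_div, Complex.norm_natCast]
    exact div_le_div_of_nonneg_right (hB 0) hN'.le
  have hsplit : ∀ α β : ℝ,
      ((1 / (N : ℝ) ^ 2 : ℝ) : ℂ) * (∑' ℓ : ℤ, FT f (2 * π * ℓ / N) *
            ((‖∑ j ∈ Finset.Icc 1 N, Complex.exp (Complex.I *
                ((t * ℓ * (α * (j : ℝ) ^ 2 / N + β * j) : ℝ) : ℂ))‖ ^ 2 : ℝ) : ℂ))
          - ((f 0 : ℂ) + FT f 0) = D + ((1 / (N : ℝ) ^ 2 : ℝ) : ℂ) * V α β := by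
    intro α β
    rw [tsum_pairCorrelation_eq t α β (R * N) N a (hRz N hN0), ha0]
    have : (N : ℂ) ≠ 0 := by exact_mod_cast hN0.ne'
    simp only [D]
    push_cast
    field_simp
    ring
  have hint : ∫ α in (-T)..T, ∫ β in (-T)..T, ‖D + ((1 / (N : ℝ) ^ 2 : ℝ) : ℂ) * V α β‖ ^ 2 ≤
      (2 * T) ^ 2 * (2 * (C₁ / N) ^ 2) +
        2 / (N : ℝ) ^ 4 * (K * N ^ 3 * (1 + Real.log N) ^ 3) := by
    refine (integral_norm_sq_add_le T hT V (continuous_offDiagSum t (R * N) N a) D (C₁ / N) hD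
      (1 / (N : ℝ) ^ 2)).trans ?_
    have hV := integral_norm_sq_offDiagSum_le t ht T hT B R N hN0 a fun ℓ => hB _
    have h2 : 2 * (1 / (N : ℝ) ^ 2) ^ 2 = 2 / (N : ℝ) ^ 4 := by field_simp
    rw [h2]
    refine add_le_add_right (mul_le_mul_of_nonneg_left (hV.trans (le_of_eq ?_)) (by positivity)) _
    simp only [K]
    ring
  simp_rw [hsplit]
  set y := Real.log N
  have hy1 : (1 + y) ^ 3 ≤ 27 * y ^ 3 := by
    calc (1 + y) ^ 3 ≤ (3 * y) ^ 3 := pow_le_pow_left₀ (by linarith) (by linarith) 3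
      _ = _ := by ring
  have hy2 : 1 ≤ 8 * y ^ 3 := by
    calc (1 : ℝ) = 8 * (1 / 2) ^ 3 := by norm_num
      _ ≤ _ := by gcongr
  calc _ ≤ 1 / (2 * T) ^ 2 * ((2 * T) ^ 2 * (2 * (C₁ / N) ^ 2) +
        2 / (N : ℝ) ^ 4 * (K * N ^ 3 * (1 + y) ^ 3)) :=
        mul_le_mul_of_nonneg_left hint (by positivity)
    _ = (2 * C₁ ^ 2 * (1 / N) + 2 * K / (2 * T) ^ 2 * (1 + y) ^ 3) / N := by
        field_simp
    _ ≤ (2 * C₁ ^ 2 * (8 * y ^ 3) + 2 * K / (2 * T) ^ 2 * (27 * y ^ 3)) / N := by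
        gcongr
        exact ((div_le_one hN').2 hN1).trans hy2
    _ = _ := by ring
end
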